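/- arXiv:1811.00204 — 3 statements merged into one kernel-verified Lean document; each statement's English description precedes it below -/
import Mathlib

section
/- Let K be a field, let q ≥ 2 be an integer, and let S be a finite multiset of nonzero elements of K such that the multiset obtained from S by raising every element to the q-th power is equal to S. Then every element a of S is a root of unity; more precisely, for each a ∈ S there exists an integer n with 0 < n < q^(card S) such that a^n = 1. -/
/-- Grothendieck's quasi-unipotence argument: a finite multiset of nonzero elements of a
field that is stable under raising every element to the `q`-th power (`q ≥ 2`) consists
entirely of roots of unity, of order less than `q ^ (card S)`. -/
theorem multiset_stable_under_pow_qth_roots_of_unity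
    {K : Type*} [Field K] (q : ℕ) (hq : 2 ≤ q) (S : Multiset K)
    (hS0 : ∀ a ∈ S, a ≠ 0) (hSq : S.map (fun x => x ^ q) = S) :
    ∀ a ∈ S, ∃ n : ℕ, 0 < n ∧ n < q ^ Multiset.card S ∧ a ^ n = 1 := by
  classical
  intro a ha
  have hmem : ∀ i : ℕ, a ^ q ^ i ∈ S := by
    intro i
    induction i with
    | zero => simpa using ha
    | succ i ih =>
      rw [← hSq, pow_succ, pow_mul]
      exact Multiset.mem_map_of_mem (fun x => x ^ q) ih
  have hcard : S.toFinset.card < (Finset.range (Multiset.card S + 1)).card := by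
    rw [Finset.card_range]
    exact Nat.lt_succ_of_le (Multiset.toFinset_card_le S)
  obtain ⟨i, hi, j, hj, hne, hij⟩ := Finset.exists_ne_map_eq_of_card_lt_of_maps_to hcard
    (f := fun i => a ^ q ^ i) (fun i _ => Multiset.mem_toFinset.2 (hmem i))
  wlog hlt : i < j generalizing i j
  · exact this j hj i hi hne.symm hij.symm (by omega)
  have hpow : q ^ i < q ^ j := Nat.pow_lt_pow_right hq hlt
  have hle : q ^ j ≤ q ^ Multiset.card S :=
    Nat.pow_le_pow_right (by omega) (Nat.lt_succ_iff.1 (Finset.mem_range.1 hj))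
  have hpos : 0 < q ^ i := Nat.pow_pos (by omega)
  refine ⟨q ^ j - q ^ i, by omega, by omega, ?_⟩
  apply mul_right_cancel₀ (pow_ne_zero (q ^ i) (hS0 a ha))
  rw [← pow_add, Nat.sub_add_cancel hpow.le, one_mul]
  exact hij.symm
end

section
/- Let K be an algebraically closed field, let r be a positive integer, let q ≥ 2 be an integer, and let A and B be invertible r × r matrices over K satisfying B * A * B⁻¹ = A^q. Then every eigenvalue λ of A (that is, every root of the characteristic polynomial of A) is a root of unity; more precisely, λ^n = 1 for some integer n with 0 < n < q^r. -/
/-- If `A` is conjugate to `A ^ q`, then the spectrum of `A` is stable under `x ↦ x ^ q`. -/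
theorem Matrix.pow_mem_spectrum_of_conj_eq_pow {K ι : Type*} [Field K] [Fintype ι]
    [DecidableEq ι] {A B : Matrix ι ι K} {q : ℕ} (hB : IsUnit B.det)
    (hconj : B * A * B⁻¹ = A ^ q) {x : K} (hx : x ∈ spectrum K A) :
    x ^ q ∈ spectrum K A := by
  have h : spectrum K (B * A * B⁻¹) = spectrum K A :=
    spectrum.units_conjugate (u := B.nonsingInvUnit hB)
  rw [← h, hconj]
  exact spectrum.pow_mem_pow A q hx

/-- A nonzero element of a finite set of `r` elements of a field stable under `x ↦ x ^ q` is a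
root of unity of order less than `q ^ r`. -/
theorem exists_pow_eq_one_of_pow_mem {K : Type*} [Field K] {q r : ℕ} (hq : 2 ≤ q)
    {S : Finset K} (hcard : S.card ≤ r) (hS : ∀ x ∈ S, x ^ q ∈ S) {x : K} (hx : x ∈ S)
    (hx0 : x ≠ 0) : ∃ n : ℕ, 0 < n ∧ n < q ^ r ∧ x ^ n = 1 := by
  have hmem (i : ℕ) : x ^ q ^ i ∈ S := by
    induction i with
    | zero => simpa using hx
    | succ i ih => simpa [pow_succ, pow_mul] using hS _ ih
  obtain ⟨i, hi, j, hj, hne, heq⟩ := Finset.exists_ne_map_eq_of_card_lt_of_maps_to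
    (s := Finset.range (r + 1)) (t := S) (f := fun i => x ^ q ^ i)
    (by simpa using Nat.lt_succ_of_le hcard) (fun i _ => hmem i)
  wlog hij : i < j generalizing i j
  · exact this j hj i hi hne.symm heq.symm (by omega)
  have hlt : q ^ i < q ^ j := Nat.pow_lt_pow_right (by omega) hij
  have hle : q ^ j ≤ q ^ r :=
    Nat.pow_le_pow_right (by omega) (Nat.lt_succ_iff.mp (Finset.mem_range.mp hj))
  have hpos : 0 < q ^ i := Nat.pow_pos (by omega)
  refine ⟨q ^ j - q ^ i, by omega, by omega, ?_⟩
  rw [pow_sub₀ x hx0 hlt.le, ← heq]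
  exact mul_inv_cancel₀ (pow_ne_zero _ hx0)


/-- Matrix form of Grothendieck's quasi-unipotence argument: if `B * A * B⁻¹ = A ^ q`
for invertible `r × r` matrices over an algebraically closed field and `q ≥ 2`, then every
eigenvalue of `A` is a root of unity of order less than `q ^ r`. -/
theorem eigenvalues_roots_of_unity_of_conj_pow
    {K : Type*} [Field K] [IsAlgClosed K] (r q : ℕ) (hr : 0 < r) (hq : 2 ≤ q)
    (A B : Matrix (Fin r) (Fin r) K) (hA : IsUnit A.det) (hB : IsUnit B.det)
    (hconj : B * A * B⁻¹ = A ^ q) :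
    ∀ lam : K, (Matrix.charpoly A).IsRoot lam →
      ∃ n : ℕ, 0 < n ∧ n < q ^ r ∧ lam ^ n = 1 := by
  classical
  intro lam hlam
  have hmem (x : K) : x ∈ A.charpoly.roots.toFinset ↔ x ∈ spectrum K A := by
    rw [Multiset.mem_toFinset, Polynomial.mem_roots A.charpoly_monic.ne_zero,
      Matrix.mem_spectrum_iff_isRoot_charpoly]
  have hspec : lam ∈ spectrum K A := Matrix.mem_spectrum_iff_isRoot_charpoly.mpr hlam
  refine exists_pow_eq_one_of_pow_mem hq (S := A.charpoly.roots.toFinset) ?_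
    (fun x hx => ?_) ((hmem lam).mpr hspec) ?_
  · calc A.charpoly.roots.toFinset.card ≤ A.charpoly.roots.card := Multiset.toFinset_card_le _
      _ ≤ A.charpoly.natDegree := A.charpoly.card_roots'
      _ = r := by simp
  · exact (hmem _).mpr (Matrix.pow_mem_spectrum_of_conj_eq_pow hB hconj ((hmem x).mp hx))
  · rintro rfl
    exact spectrum.zero_notMem K ((Matrix.isUnit_iff_isUnit_det A).mpr hA) hspec
end

section
/- Let p be a prime and let k be a finite field of characteristic p with exactly p^n elements. Let W = 𝕎 k be the ring of p-typical Witt vectors of k, let K be the fraction field of W, and let σ : K ≃ K be the field automorphism induced by the Witt vector Frobenius of W. Let V be a nonzero finite-dimensional K-vector space and let F : V → V be an additive bijection that is σ-semilinear, i.e. F(c • v) = σ(c) • F(v) for all c ∈ K and v ∈ V. Suppose there exists a finitely generated W-submodule T of V which spans V as a K-vector space and satisfies F(T) = T. Then: (1) σ^n is the identity on K, so the n-fold iterate F^n is a K-linear automorphism of V; (2) every coefficient of the characteristic polynomial of the K-linear endomorphism F^n lies in the image of W in K; and (3) the constant coefficient of this characteristic polynomial is the image of a unit of W. (Consequently all roots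 of the characteristic polynomial have p-adic valuation 0.) -/
open Module in
/-- The matrix of a `K`-linear map in a basis coming from a stable lattice is the base change of
the matrix of its restriction to the lattice. -/
theorem LinearMap.toMatrix_extendOfIsLattice {R K V ι : Type*} [CommRing R] [IsDomain R]
    [Field K] [Algebra R K] [IsFractionRing R K] [AddCommGroup V] [Module R V] [Module K V]
    [IsScalarTower R K V] [Fintype ι] [DecidableEq ι] (M : Submodule R V)
    [Submodule.IsLattice K M] (b : Basis ι R M) (G : V →ₗ[K] V) (g : M →ₗ[R] M)
    (hg : ∀ x : M, (g x : V) = G x) :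
    LinearMap.toMatrix (b.extendOfIsLattice K) (b.extendOfIsLattice K) G =
      (LinearMap.toMatrix b b g).map (algebraMap R K) := by
  apply (Matrix.toLin (b.extendOfIsLattice K) (b.extendOfIsLattice K)).injective
  rw [Matrix.toLin_toMatrix]
  refine (b.extendOfIsLattice K).ext fun j => ?_
  rw [Matrix.toLin_self]
  have h := congrArg M.subtype (b.sum_repr (g (b j)))
  simp only [map_sum, map_smul, Submodule.subtype_apply, hg] at h
  simpa [LinearMap.toMatrix_apply] using h.symm

/-- The characteristic polynomial of a `K`-linear map preserving a free lattice is the image of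
the characteristic polynomial of its restriction to the lattice. -/
theorem LinearMap.charpoly_eq_map_of_isLattice {R K V : Type*} [CommRing R] [IsDomain R]
    [Field K] [Algebra R K] [IsFractionRing R K] [AddCommGroup V] [Module R V] [Module K V]
    [IsScalarTower R K V] [FiniteDimensional K V] (M : Submodule R V)
    [Submodule.IsLattice K M] [Module.Finite R M] [Module.Free R M]
    (G : V →ₗ[K] V) (g : M →ₗ[R] M) (hg : ∀ x : M, (g x : V) = G x) :
    G.charpoly = g.charpoly.map (algebraMap R K) := by
  classical
  let b := Module.Free.chooseBasis R M
  rw [← LinearMap.charpoly_toMatrix G (b.extendOfIsLattice K), ← LinearMap.charpoly_toMatrix g b,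
    LinearMap.toMatrix_extendOfIsLattice M b G g hg, Matrix.charpoly_map]

/-- The constant coefficient of the characteristic polynomial of a bijective linear map of a
finite free module is a unit. -/
theorem LinearMap.isUnit_charpoly_coeff_zero {R M : Type*} [CommRing R] [Nontrivial R]
    [AddCommGroup M] [Module R M] [Module.Finite R M] [Module.Free R M] (g : M →ₗ[R] M)
    (hg : Function.Bijective g) : IsUnit (g.charpoly.coeff 0) := by
  have h : IsUnit (LinearMap.det g) := (LinearEquiv.ofBijective g hg).isUnit_det'
  rw [LinearMap.det_eq_sign_charpoly_coeff] at h
  exact isUnit_of_mul_isUnit_right h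

/-- Over a finite field with `p ^ n` elements, the `n`-th iterate of the Witt vector Frobenius is
the identity. -/
theorem WittVector.iterate_frobeniusEquiv_of_card {p : ℕ} [Fact p.Prime] {n : ℕ} {k : Type*}
    [Field k] [Fintype k] [CharP k p] (hcard : Fintype.card k = p ^ n) (w : WittVector p k) :
    (WittVector.frobeniusEquiv p k)^[n] w = w := by
  ext i
  have h : ∀ m : ℕ, ((WittVector.frobeniusEquiv p k)^[m] w).coeff i = w.coeff i ^ p ^ m := by
    intro m
    induction m with
    | zero => simp
    | succ m ih =>
      rw [Function.iterate_succ_apply', pow_succ, pow_mul, ← ih]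
      exact WittVector.coeff_frobenius_charP p _ i
  rw [h, ← hcard, FiniteField.pow_card]

/-- An `F`-isocrystal over a finite field `k` with `p ^ n` elements which admits a
Frobenius-stable lattice is unit-root: writing `W = 𝕎 k`, `K = Frac W`, and `σ` for the
automorphism of `K` induced by the Witt vector Frobenius, if `F : V → V` is a
`σ`-semilinear additive bijection of a nonzero finite-dimensional `K`-vector space
preserving a finitely generated `W`-submodule `T` spanning `V`, then `σ ^ n = id` (so
`F ^ n` is `K`-linear), the characteristic polynomial of `F ^ n` has coefficients in
(the image of) `W`, and its constant coefficient is (the image of) a unit of `W`. -/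
theorem unit_root_isocrystal_charpoly
    (p : ℕ) [Fact p.Prime] (n : ℕ) (hn : 0 < n)
    (k : Type) [Field k] [Fintype k] [CharP k p] (hcard : Fintype.card k = p ^ n)
    (σ : FractionRing (WittVector p k) ≃+* FractionRing (WittVector p k))
    (hσ : ∀ w : WittVector p k,
      σ (algebraMap (WittVector p k) (FractionRing (WittVector p k)) w) =
        algebraMap (WittVector p k) (FractionRing (WittVector p k))
          (WittVector.frobeniusEquiv p k w))
    (V : Type) [AddCommGroup V] [Module (FractionRing (WittVector p k)) V]
    [FiniteDimensional (FractionRing (WittVector p k)) V] [Nontrivial V]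
    (F : V → V) (hFbij : Function.Bijective F)
    (hFadd : ∀ v w : V, F (v + w) = F v + F w)
    (hFsemi : ∀ (c : FractionRing (WittVector p k)) (v : V), F (c • v) = σ c • F v)
    (T : Set V)
    (hTfg : ∃ (m : ℕ) (t : Fin m → V),
      T = {v | ∃ c : Fin m → WittVector p k,
        v = ∑ i, algebraMap (WittVector p k) (FractionRing (WittVector p k)) (c i) • t i})
    (hTspan : Submodule.span (FractionRing (WittVector p k)) T = ⊤)
    (hFT : F '' T = T) :
    (∀ c : FractionRing (WittVector p k), (⇑σ)^[n] c = c) ∧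
    (∀ (c : FractionRing (WittVector p k)) (v : V), F^[n] (c • v) = c • F^[n] v) ∧
    ∃ G : V →ₗ[FractionRing (WittVector p k)] V, ⇑G = F^[n] ∧
      (∀ i : ℕ, (LinearMap.charpoly G).coeff i ∈
        (algebraMap (WittVector p k) (FractionRing (WittVector p k))).range) ∧
      ∃ u : (WittVector p k)ˣ, (LinearMap.charpoly G).coeff 0 =
        algebraMap (WittVector p k) (FractionRing (WittVector p k)) u := by
  have hσn : ∀ c, (⇑σ)^[n] c = c := by
    have hW : ∀ (m : ℕ) (w : WittVector p k),
        (⇑σ)^[m] (algebraMap _ (FractionRing (WittVector p k)) w) =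
          algebraMap _ _ ((WittVector.frobeniusEquiv p k)^[m] w) := fun m w =>
      ((Function.Semiconj.iterate_right
        (f := algebraMap (WittVector p k) (FractionRing (WittVector p k)))
        (fun w => (hσ w).symm) m) w).symm
    intro c
    obtain ⟨x, y, -, rfl⟩ := IsFractionRing.div_surjective (A := WittVector p k) c
    have hdiv : ∀ m : ℕ, ∀ a b, (⇑σ)^[m] (a / b) = (⇑σ)^[m] a / (⇑σ)^[m] b := by
      intro m
      induction m with
      | zero => simp
      | succ m ih => intro a b; simp only [Function.iterate_succ_apply, map_div₀, ih]
    rw [hdiv, hW, hW, WittVector.iterate_frobeniusEquiv_of_card hcard,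
      WittVector.iterate_frobeniusEquiv_of_card hcard]
  have hsmul : ∀ (c : FractionRing (WittVector p k)) (v : V), F^[n] (c • v) = c • F^[n] v := by
    have h : ∀ (m : ℕ) (c : FractionRing (WittVector p k)) (v : V),
        F^[m] (c • v) = (⇑σ)^[m] c • F^[m] v := by
      intro m
      induction m with
      | zero => simp
      | succ m ih => intro c v; simp only [Function.iterate_succ_apply, hFsemi, ih]
    intro c v
    rw [h, hσn]
  have hadd : ∀ v w : V, F^[n] (v + w) = F^[n] v + F^[n] w :=
    iterate_map_add (AddMonoidHom.mk' F hFadd) n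
  let G : V →ₗ[FractionRing (WittVector p k)] V :=
    { toFun := F^[n], map_add' := hadd, map_smul' := hsmul }
  refine ⟨hσn, hsmul, G, rfl, ?_⟩
  let : Module (WittVector p k) V :=
    Module.compHom V (algebraMap (WittVector p k) (FractionRing (WittVector p k)))
  have : IsScalarTower (WittVector p k) (FractionRing (WittVector p k)) V :=
    IsScalarTower.of_algebraMap_smul fun _ _ => rfl
  obtain ⟨m, t, ht⟩ := hTfg
  let M : Submodule (WittVector p k) V := Submodule.span _ (Set.range t)
  have hM : (M : Set V) = T := by
    ext v
    simp only [M, SetLike.mem_coe, Submodule.mem_span_range_iff_exists_fun, ht,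
      Set.mem_ofPred_eq, algebraMap_smul, eq_comm]
  have : Submodule.IsLattice (FractionRing (WittVector p k)) M :=
    ⟨Submodule.fg_span (Set.finite_range t), by rw [hM, hTspan]⟩
  have : Module.Finite (WittVector p k) M :=
    Submodule.IsLattice.finite (FractionRing (WittVector p k)) M
  have : Module.Free (WittVector p k) M :=
    Submodule.IsLattice.free (FractionRing (WittVector p k)) M
  have hbij : Set.BijOn F^[n] (M : Set V) M := by
    rw [hM]
    exact (Set.BijOn.mk (Set.mapsTo_iff_image_subset.2 hFT.le) hFbij.injective.injOn
      hFT.ge).iterate n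
  let g : M →ₗ[WittVector p k] M :=
    (G.restrictScalars (WittVector p k)).restrict fun x hx => hbij.mapsTo hx
  have hchar := LinearMap.charpoly_eq_map_of_isLattice M G g fun _ => rfl
  obtain ⟨u, hu⟩ := LinearMap.isUnit_charpoly_coeff_zero g hbij.bijective
  refine ⟨fun i => ?_, u, ?_⟩
  · rw [hchar, Polynomial.coeff_map]
    exact ⟨_, rfl⟩
  · rw [hchar, Polynomial.coeff_map, hu]
end
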